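/- For every finite simple graph G with at least one edge, there exists a vertex w of G such that the co-chordal cover number of the graph G − N_G[w] (obtained by deleting the closed neighborhood of w) is at most cochord(G) − 1. -/

import Mathlib

open SimpleGraph

namespace Paper

/-- The complete graph on two vertices, `K₂`. -/
def k2 : SimpleGraph (Fin 2) := ⊤

/-- The 5-cycle `C₅`. -/
def cycle5 : SimpleGraph (ZMod 5) := SimpleGraph.fromRel (fun a b => b = a + 1)

/-- A graph is chordal if it has no induced cycle of length at least four. -/
def IsChordal {V : Type*} (G : SimpleGraph V) : Prop :=
  ∀ n : ℕ, 4 ≤ n → IsEmpty (SimpleGraph.cycleGraph n ↪g G)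

/-- A graph is co-chordal if its complement is chordal. -/
def IsCochordal {V : Type*} (G : SimpleGraph V) : Prop := IsChordal Gᶜ

/-- The co-chordal cover number: the minimum number of co-chordal subgraphs of `G`
needed to cover all edges of `G`. -/
noncomputable def cochord {V : Type*} (G : SimpleGraph V) : ℕ :=
  sInf { t | ∃ f : Fin t → SimpleGraph V,
    (∀ i, f i ≤ G ∧ IsCochordal (f i)) ∧ ∀ ⦃u v : V⦄, G.Adj u v → ∃ i, (f i).Adj u v }

/-- The closed neighborhood `N_G[w]`. -/
def closedNbhd {V : Type*} (G : SimpleGraph V) (w : V) : Set V :=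
  insert w (G.neighborSet w)

/-- The graph `G - N_G[w]`: the induced subgraph on the complement of the closed
neighborhood of `w`. -/
def delClosedNbhd {V : Type*} (G : SimpleGraph V) (w : V) :
    SimpleGraph ((closedNbhd G w)ᶜ : Set V) := G.induce _

/-- A geodesic between two reachable vertices, parametrised by the distance from its start. -/
theorem exists_geodesic {V : Type*} {H : SimpleGraph V} {x y : V} (h : H.Reachable x y) :
    ∃ p : ℕ → V, p 0 = x ∧ p (H.dist x y) = y ∧
      (∀ i < H.dist x y, H.Adj (p i) (p (i + 1))) ∧
      (∀ i ≤ H.dist x y, H.dist x (p i) = i) := by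
  obtain ⟨w, hw⟩ := h.exists_walk_length_eq_dist
  refine ⟨w.getVert, w.getVert_zero, by rw [← hw, w.getVert_length],
    fun i hi => w.adj_getVert_succ (hw ▸ hi), fun i hi => ?_⟩
  have h1 : H.dist x (w.getVert i) ≤ i :=
    (dist_le (w.take i)).trans (by simp [Walk.take_length])
  have h2 : H.dist (w.getVert i) y ≤ H.dist x y - i :=
    (dist_le (w.drop i)).trans (by simp [Walk.drop_length, hw])
  have h3 := Reachable.dist_triangle_left (w.take i).reachable y
  omega

/-- Adjacency in a cycle graph, for ordered endpoints. -/
theorem cycleGraph_adj_of_lt {n : ℕ} {a b : Fin n} (hab : a < b) :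
    (cycleGraph n).Adj a b ↔ b.val = a.val + 1 ∨ (a.val = 0 ∧ b.val + 1 = n) := by
  have h : a.val < b.val := hab
  have hb := b.isLt
  rw [cycleGraph_adj', Fin.coe_sub_iff_lt.mpr hab, Fin.coe_sub_iff_le.mpr hab.le]
  omega

/-- To embed a cycle as an induced subgraph it suffices to check ordered pairs. -/
theorem IsChordal.not_isInducedCycle {V : Type*} {G : SimpleGraph V} (hG : IsChordal G) {n : ℕ}
    (hn : 4 ≤ n) (q : ℕ → V)
    (hne : ∀ i j, i < j → j < n → q i ≠ q j)
    (hadj : ∀ i j, i < j → j < n → (G.Adj (q i) (q j) ↔ j = i + 1 ∨ (i = 0 ∧ j + 1 = n))) :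
    False := by
  refine (hG n hn).false ⟨⟨fun i => q i, fun a b hab => ?_⟩, fun {a b} => ?_⟩
  · rcases lt_trichotomy a b with h | h | h
    · exact absurd hab (hne _ _ h b.isLt)
    · exact h
    · exact absurd hab.symm (hne _ _ h a.isLt)
  · change G.Adj (q a) (q b) ↔ _
    rcases lt_trichotomy a b with h | h | h
    · rw [hadj _ _ h b.isLt, cycleGraph_adj_of_lt h]
    · simp [h]
    · rw [G.adj_comm, (cycleGraph n).adj_comm, hadj _ _ h a.isLt, cycleGraph_adj_of_lt h]

/-- The edges of `G` with both ends in `s`, as a graph on all vertices. -/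
def restrictTo {V : Type*} (G : SimpleGraph V) (s : Set V) : SimpleGraph V where
  Adj a b := G.Adj a b ∧ a ∈ s ∧ b ∈ s
  symm := ⟨fun _ _ h => ⟨h.1.symm, h.2.2, h.2.1⟩⟩
  loopless := ⟨fun _ h => G.irrefl h.1⟩

theorem restrictTo_mono {V : Type*} (G : SimpleGraph V) {s t : Set V} (h : s ⊆ t) :
    restrictTo G s ≤ restrictTo G t :=
  fun _ _ hab => ⟨hab.1, h hab.2.1, h hab.2.2⟩

/-- In a chordal graph, two neighbours of `v` joined by a path avoiding the rest of the closed
neighbourhood of `v` are adjacent. -/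
theorem IsChordal.adj_of_reachable {V : Type*} {G : SimpleGraph V} (hG : IsChordal G)
    {v x y : V} (hx : G.Adj v x) (hy : G.Adj v y) (hxy : x ≠ y) {U : Set V}
    (hU : ∀ u ∈ U, u ≠ v ∧ ¬ G.Adj v u)
    (hr : (restrictTo G (insert x (insert y U))).Reachable x y) : G.Adj x y := by
  by_contra hnot
  set H := restrictTo G (insert x (insert y U)) with hH
  obtain ⟨p, hp0, hpl, hstep, hdist⟩ := exists_geodesic hr
  set l := H.dist x y with hl
  have hl0 : l ≠ 0 := fun h => hxy (by rw [← hp0, ← hpl, h])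
  have hl1 : l ≠ 1 := fun h => hnot (dist_eq_one_iff_adj.mp h).1
  have hmem : ∀ i ≤ l, p i ∈ insert x (insert y U) := by
    intro i hi
    rcases hi.lt_or_eq with h | h
    · exact (hstep i h).2.1
    · rw [h, hpl]; simp
  have hinj : ∀ i ≤ l, ∀ j ≤ l, p i = p j → i = j := by
    intro i hi j hj h
    rw [← hdist i hi, ← hdist j hj, h]
  have hind : ∀ i j, i < j → j ≤ l → G.Adj (p i) (p j) → j = i + 1 := by
    intro i j hij hj h
    have hH' : H.Adj (p i) (p j) := ⟨h, hmem i (by omega), hmem j hj⟩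
    have hreach : H.Reachable (p i) (p j) := hH'.reachable
    have h1 := hreach.dist_triangle_right x
    rw [dist_eq_one_iff_adj.mpr hH', hdist i (by omega), hdist j hj] at h1
    omega
  have hinner : ∀ i, 0 < i → i < l → p i ∈ U := by
    intro i h0 hil
    rcases hmem i hil.le with h | h | h
    · have := hinj i hil.le 0 (by omega) (h.trans hp0.symm); omega
    · have := hinj i hil.le l le_rfl (h.trans hpl.symm); omega
    · exact h
  have hne : ∀ i ≤ l, p i ≠ v := by
    intro i hi h
    rcases hmem i hi with h' | h' | h'
    · exact hx.ne (h.symm.trans h')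
    · exact hy.ne (h.symm.trans h')
    · exact (hU _ h').1 h
  have hv : ∀ i ≤ l, (G.Adj (p i) v ↔ i = 0 ∨ i = l) := by
    intro i hi
    refine ⟨fun h => ?_, ?_⟩
    · by_contra hc
      exact (hU _ (hinner i (by omega) (by omega))).2 h.symm
    · rintro (rfl | rfl)
      · rw [hp0]; exact hx.symm
      · rw [hpl]; exact hy.symm
  refine hG.not_isInducedCycle (n := l + 2) (by omega) (fun i => if i ≤ l then p i else v) ?_ ?_
  · intro i j hij hj
    simp only [show i ≤ l by omega, if_true]
    split_ifs with h
    · exact fun h' => hij.ne (hinj _ (by omega) _ h h')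
    · exact hne i (by omega)
  · intro i j hij hj
    simp only [show i ≤ l by omega, if_true]
    split_ifs with h
    · refine ⟨fun h' => Or.inl (hind i j hij h h'), ?_⟩
      rintro (rfl | h')
      · exact (hstep i (by omega)).1
      · omega
    · rw [hv i (by omega)]
      omega

/-- Dirac: a non-universal vertex `v` of an induced subgraph of a chordal graph has a
non-neighbour which is simplicial in that induced subgraph. -/
theorem IsChordal.exists_simplicial_not_adj {V : Type*} [Finite V] {G : SimpleGraph V}
    (hG : IsChordal G) (W : Set V) :
    ∀ v ∈ W, (∃ u ∈ W, u ≠ v ∧ ¬ G.Adj v u) →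
      ∃ z ∈ W, z ≠ v ∧ ¬ G.Adj v z ∧ G.IsClique (W ∩ G.neighborSet z) := by
  induction W using WellFoundedLT.induction with
  | ind W ih =>
  rintro v hvW ⟨c, hcW, hcv, hvc⟩
  set U : Set V := {u | u ∈ W ∧ u ≠ v ∧ ¬ G.Adj v u} with hUdef
  set C : Set V := {u | (restrictTo G U).Reachable c u} with hC
  have hCU : C ⊆ U := by
    intro u hu
    obtain ⟨_ | ⟨h, _⟩⟩ := Reachable.symm hu
    · exact ⟨hcW, hcv, hvc⟩
    · exact h.2.1
  set S : Set V := {s | s ∈ W ∧ G.Adj v s ∧ ∃ u ∈ C, G.Adj s u} with hS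
  have hSclique : G.IsClique S := by
    rintro x ⟨-, hvx, a, ha, hxa⟩ y ⟨-, hvy, b, hb, hyb⟩ hxy
    refine hG.adj_of_reachable hvx hvy hxy (U := U) (fun u hu => hu.2) ?_
    have h1 : (restrictTo G (insert x (insert y U))).Adj x a :=
      ⟨hxa, by simp, by simp [hCU ha]⟩
    have h2 : (restrictTo G (insert x (insert y U))).Adj y b :=
      ⟨hyb, by simp, by simp [hCU hb]⟩
    have h3 : (restrictTo G U).Reachable a b := Reachable.trans (Reachable.symm ha) hb
    have hsub : U ⊆ insert x (insert y U) := fun u hu => by simp [hu]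
    exact (h1.reachable.trans (h3.mono (restrictTo_mono G hsub))).trans h2.symm.reachable
  have hnbr : ∀ z ∈ C, W ∩ G.neighborSet z ⊆ C ∪ S := by
    rintro z hz a ⟨haW, hza⟩
    have hzU := hCU hz
    by_cases hva : G.Adj v a
    · exact Or.inr ⟨haW, hva, z, hz, hza.symm⟩
    · refine Or.inl ?_
      have hav : a ≠ v := by rintro rfl; exact hzU.2.2 hza.symm
      have : (restrictTo G U).Adj z a := ⟨hza, hzU, haW, hav, hva⟩
      exact Reachable.trans hz this.reachable
  have hcC : c ∈ C := Reachable.refl c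
  have hCS : C ∪ S ⊆ W := by
    rintro a (ha | ha)
    · exact (hCU ha).1
    · exact ha.1
  have hvCS : v ∉ C ∪ S := by
    rintro (h | h)
    · exact (hCU h).2.1 rfl
    · exact G.irrefl h.2.1
  suffices ∃ z ∈ C, G.IsClique ((C ∪ S) ∩ G.neighborSet z) by
    obtain ⟨z, hz, hcl⟩ := this
    exact ⟨z, (hCU hz).1, (hCU hz).2.1, (hCU hz).2.2,
      IsClique.subset (Set.subset_inter (hnbr z hz) Set.inter_subset_right) hcl⟩
  have hlt : C ∪ S < W := ⟨hCS, fun h => hvCS (h hvW)⟩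
  have hltC : C < W := ⟨Set.subset_union_left.trans hCS, fun h => hvCS (Or.inl (h hvW))⟩
  by_cases hs : ∃ s ∈ S, ∃ u ∈ C ∪ S, u ≠ s ∧ ¬ G.Adj s u
  · obtain ⟨s, hsS, hu⟩ := hs
    obtain ⟨z, hz, hzs, hsz, hcl⟩ := ih _ hlt s (Or.inr hsS) hu
    rcases hz with hz | hz
    · exact ⟨z, hz, hcl⟩
    · exact absurd (hSclique hsS hz hzs.symm) hsz
  · push Not at hs
    obtain ⟨z, hz, hcl⟩ : ∃ z ∈ C, G.IsClique (C ∩ G.neighborSet z) := by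
      by_cases hu : ∃ a ∈ C, ∃ u ∈ C, u ≠ a ∧ ¬ G.Adj a u
      · obtain ⟨a, ha, hu⟩ := hu
        obtain ⟨z, hz, -, -, hcl⟩ := ih _ hltC a ha hu
        exact ⟨z, hz, hcl⟩
      · push Not at hu
        exact ⟨c, hcC, fun a ha b hb hab => hu a ha.1 b hb.1 hab.symm⟩
    refine ⟨z, hz, fun a ha b hb hab => ?_⟩
    rcases ha.1 with haC | haS
    · rcases hb.1 with hbC | hbS
      · exact hcl ⟨haC, ha.2⟩ ⟨hbC, hb.2⟩ hab
      · exact (hs b hbS a ha.1 hab).symm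
    · exact hs a haS b hb.1 hab.symm

/-- Dirac: a nonempty finite chordal graph has a simplicial vertex. -/
theorem IsChordal.exists_simplicial {V : Type*} [Finite V] [Nonempty V] {G : SimpleGraph V}
    (hG : IsChordal G) : ∃ z, G.IsClique (G.neighborSet z) := by
  by_cases hu : ∃ a u, u ≠ a ∧ ¬ G.Adj a u
  · obtain ⟨a, u, hu⟩ := hu
    obtain ⟨z, -, -, -, hcl⟩ :=
      hG.exists_simplicial_not_adj Set.univ a (Set.mem_univ a) ⟨u, Set.mem_univ u, hu⟩
    exact ⟨z, by simpa using hcl⟩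
  · push Not at hu
    exact ⟨Classical.arbitrary V, fun a _ b _ hab => hu a b hab.symm⟩

theorem IsCochordal.induce {V : Type*} {G : SimpleGraph V} (hG : IsCochordal G) (s : Set V) :
    IsCochordal (G.induce s) := by
  intro n hn
  refine ⟨fun e => (hG n hn).false
    ⟨⟨fun i => (e i : V), fun a b h => e.injective (Subtype.ext h)⟩, fun {a b} => ?_⟩⟩
  rw [← e.map_adj_iff]
  change Gᶜ.Adj (e a) (e b) ↔ _
  simp [compl_adj, ← Subtype.ext_iff]

theorem isCochordal_edge {V : Type*} (u v : V) : IsCochordal (edge u v) := by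
  refine fun n hn => ⟨fun e => ?_⟩
  have key : ∀ a b : Fin n, a.val + 2 = b.val → b.val ≤ 3 → (edge u v).Adj (e a) (e b) := by
    intro a b hab hb
    have hlt : a < b := by rw [Fin.lt_def]; omega
    have hne : e a ≠ e b := e.injective.ne hlt.ne
    have hn' : ¬ (cycleGraph n).Adj a b := by
      rw [cycleGraph_adj_of_lt hlt]; omega
    rw [← e.map_adj_iff, compl_adj] at hn'
    by_contra hc
    exact hn' ⟨hne, hc⟩
  have h02 := key ⟨0, by omega⟩ ⟨2, by omega⟩ rfl (by simp)
  have h13 := key ⟨1, by omega⟩ ⟨3, by omega⟩ rfl (by simp)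
  have h01 : e ⟨0, by omega⟩ ≠ e ⟨1, by omega⟩ := e.injective.ne (by simp)
  have h03 : e ⟨0, by omega⟩ ≠ e ⟨3, by omega⟩ := e.injective.ne (by simp)
  rw [edge_adj] at h02 h13
  grind

/-- The cover defining `cochord` exists for every finite graph. -/
theorem exists_cochordal_cover {V : Type*} [Finite V] (G : SimpleGraph V) :
    ∃ f : Fin (cochord G) → SimpleGraph V,
      (∀ i, f i ≤ G ∧ IsCochordal (f i)) ∧ ∀ ⦃u v : V⦄, G.Adj u v → ∃ i, (f i).Adj u v := by
  refine Nat.sInf_mem (s := { t | ∃ f : Fin t → SimpleGraph V,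
    (∀ i, f i ≤ G ∧ IsCochordal (f i)) ∧ ∀ ⦃u v : V⦄, G.Adj u v → ∃ i, (f i).Adj u v }) ?_
  obtain ⟨t, ⟨e⟩⟩ := Finite.exists_equiv_fin {p : V × V // G.Adj p.1 p.2}
  refine ⟨t, fun i => edge (e.symm i).1.1 (e.symm i).1.2,
    fun i => ⟨?_, isCochordal_edge _ _⟩, fun u v huv => ⟨e ⟨(u, v), huv⟩, ?_⟩⟩
  · rw [edge_le_iff]
    exact Or.inr (e.symm i).2
  · simp [edge_adj, huv.ne]

/-- For every finite simple graph `G` with at least one edge, there exists a vertex `w`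
such that `cochord(G - N_G[w]) ≤ cochord(G) - 1`. -/
theorem stmt0 {V : Type*} [Fintype V] (G : SimpleGraph V) (hE : G.edgeSet.Nonempty) :
    ∃ w : V, cochord (delClosedNbhd G w) + 1 ≤ cochord G := by
  obtain ⟨f, hf, hcov⟩ := exists_cochordal_cover G
  obtain ⟨e, he⟩ := hE
  induction e using Sym2.ind with
  | _ a b =>
  obtain ⟨i₀, -⟩ := hcov (G.mem_edgeSet.mp he)
  have : Nonempty V := ⟨a⟩
  generalize cochord G = t at *
  obtain _ | t := t
  · exact i₀.elim0
  obtain ⟨w, hw⟩ := IsChordal.exists_simplicial (hf 0).2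
  refine ⟨w, Nat.succ_le_succ (Nat.sInf_le
    ⟨fun i => (f i.succ).induce _, fun i => ⟨fun u v h => (hf i.succ).1 h, (hf _).2.induce _⟩, ?_⟩)⟩
  rintro ⟨u, hu⟩ ⟨v, hv⟩ huv
  have huv' : G.Adj u v := huv
  obtain ⟨i, hi⟩ := hcov huv'
  have hnbr : ∀ z ∈ (closedNbhd G w)ᶜ, z ∈ (f 0)ᶜ.neighborSet w := by
    intro z hz
    refine ⟨fun h => hz (Or.inl h.symm), fun h => hz (Or.inr ((hf 0).1 h))⟩
  induction i using Fin.cases with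
  | zero => exact absurd hi (hw (hnbr u hu) (hnbr v hv) huv'.ne).2
  | succ i => exact ⟨i, hi⟩

end Paper
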